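/- arXiv:2509.07912 — 4 statements merged into one kernel-verified Lean document; each statement's English description precedes it below -/
import Mathlib

section
/- Let K be a commutative ring, n, d ≥ 1, and let K[x_{ij} : i ∈ [n], j ∈ [d]] be the polynomial ring in the variables x_{ij}. For a list p = (p_1, …, p_a) of polynomials in K[y_1, …, y_d] and a multi-index α ∈ ℕ^a with |α| ≤ n, define the elementary multisymmetric function e_α(p) by the identity ∏_{i=1}^{n} (1 + p_1(i)t_1 + ⋯ + p_a(i)t_a) = Σ_{|α| ≤ n} e_α(p) t^α in K[x_{ij}][t_1,…,t_a], where p_l(i) is obtained from p_l by substituting x_{ij} for y_j. Then for all α ∈ ℕ^a, β ∈ ℕ^b with |α|, |β| ≤ n and all lists p = (p_1,…,p_a), q = (q_1,…,q_b) in K[y_1,…,y_d], one has e_α(p) · e_β(q) = Σ_{γ ∈ L(α,β,n)} e_γ(p, q, pq), where (p, q, pq) is the family indexed by ({0}∪[a]) × ({0}∪[b]) ∖ {(0,0)} assigning p_i to position (i,0), q_j to position (0,j), and the product p_i q_j to position (i,j) for i ∈ [a], j ∈ [b], and e_γ is the elementary multisymmetric function of this family with exponent multi-index γ. -/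
open MvPolynomial

/-- The elementary multisymmetric function `e_μ(p)` of a family
`p : σ → K[y_1,…,y_d]`, defined via the generating identity
`∏_{i=1}^{n} (1 + Σ_l p_l(i) t_l) = Σ_μ e_μ(p) t^μ`
in `K[x_{ij}][t_l : l ∈ σ]`, where `p_l(i)` is `p_l` with `y_j ↦ x_{ij}`:
`e_μ(p)` is the coefficient of `t^μ` in the product. -/
noncomputable def esym (K : Type*) [CommRing K] (n d : ℕ) {σ : Type*} [Fintype σ]
    (p : σ → MvPolynomial (Fin d) K) (μ : σ →₀ ℕ) :
    MvPolynomial (Fin n × Fin d) K :=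
  MvPolynomial.coeff μ
    (∏ i : Fin n,
      (1 + ∑ l : σ,
        MvPolynomial.C (MvPolynomial.rename (fun j => (i, j)) (p l)) *
          MvPolynomial.X l))

/-- Membership in `L(α,β,n)`. -/
def IsL {a b : ℕ} (α : Fin a → ℕ) (β : Fin b → ℕ) (n : ℕ)
    (γ : Fin (a+1) → Fin (b+1) → ℕ) : Prop :=
  γ 0 0 = 0 ∧
  (∑ i, ∑ j, γ i j) ≤ n ∧
  (∀ i : Fin a, ∑ j, γ i.succ j = α i) ∧
  (∀ j : Fin b, ∑ i, γ i j.succ = β j)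

/-- The family `(p, q, pq)` indexed by `({0}∪[a]) × ({0}∪[b])`, assigning `p_i`
to `(i,0)`, `q_j` to `(0,j)` and `p_i q_j` to `(i,j)` for `i ∈ [a]`, `j ∈ [b]`
(the value at `(0,0)`, excluded from the index set below, is irrelevant). -/
noncomputable def pqFamily {K : Type*} [CommRing K] {a b d : ℕ}
    (p : Fin a → MvPolynomial (Fin d) K) (q : Fin b → MvPolynomial (Fin d) K)
    (x : Fin (a+1) × Fin (b+1)) : MvPolynomial (Fin d) K :=
  if hi : x.1 = 0 then
    (if hj : x.2 = 0 then 0 else q (x.2.pred hj))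
  else
    (if hj : x.2 = 0 then p (x.1.pred hi) else p (x.1.pred hi) * q (x.2.pred hj))

/-- The coefficients of a product of `n` affine linear forms with constant term `1`, as a sum over
the choices of one term in each factor. The terms are indexed by `τ ≃ Option σ`, where the image
of `none` stands for the constant term. -/
theorem coeff_prod_one_add_sum {R σ τ ι : Type*} [CommRing R] [Fintype σ] [Fintype τ]
    [DecidableEq τ] [Fintype ι] [DecidableEq ι] (e : Option σ ≃ τ) (c : ι → τ → R)
    (hc : ∀ i, c i (e none) = 1) (μ : σ →₀ ℕ) [DecidablePred fun f : ι → τ =>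
      ∀ l, (Finset.univ.filter fun i => f i = e (some l)).card = μ l] :
    MvPolynomial.coeff μ (∏ i, (1 + ∑ l, MvPolynomial.C (c i (e (some l))) * MvPolynomial.X l)) =
      ∑ f : ι → τ, if ∀ l, (Finset.univ.filter fun i => f i = e (some l)).card = μ l
        then ∏ i, c i (f i) else 0 := by
  classical
  let v : τ → σ →₀ ℕ := fun t => (e.symm t).elim 0 fun l => Finsupp.single l 1
  have h1 : ∀ i, (1 + ∑ l, MvPolynomial.C (c i (e (some l))) * MvPolynomial.X l : MvPolynomial σ R)
      = ∑ t, MvPolynomial.monomial (v t) (c i t) := by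
    intro i
    rw [← e.sum_comp, Fintype.sum_option]
    simp [v, hc, MvPolynomial.C_mul_X_eq_monomial]
  have h2 : ∀ (f : ι → τ) (l : σ), (∑ i, v (f i)) l =
      (Finset.univ.filter fun i => f i = e (some l)).card := by
    intro f l
    rw [Finsupp.finsetSum_apply, Finset.card_filter]
    refine Finset.sum_congr rfl fun i _ => ?_
    obtain ⟨o, ho⟩ := e.surjective (f i)
    rw [← ho]
    cases o <;> simp [v, Finsupp.single_apply]
  simp_rw [h1]
  rw [Finset.prod_univ_sum, Fintype.piFinset_univ, MvPolynomial.coeff_sum]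
  refine Finset.sum_congr rfl fun f _ => ?_
  rw [← MvPolynomial.monomial_sum_prod, MvPolynomial.coeff_monomial]
  simp_rw [← h2 f, DFunLike.ext_iff]

/-- The value `p_l(i)` for `l ≥ 1`, with `p_0 = 1`. -/
noncomputable def consOneEval {K : Type*} [CommRing K] {n d a : ℕ}
    (p : Fin a → MvPolynomial (Fin d) K) (i : Fin n) :
    Fin (a + 1) → MvPolynomial (Fin n × Fin d) K :=
  Fin.cons 1 fun l => MvPolynomial.rename (fun j => (i, j)) (p l)

theorem esym_eq_sum_fin {K : Type*} [CommRing K] {n d a : ℕ}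
    (p : Fin a → MvPolynomial (Fin d) K) (α : Fin a → ℕ) :
    esym K n d p (Finsupp.equivFunOnFinite.symm α) = ∑ f : Fin n → Fin (a + 1),
      if ∀ l : Fin a, (Finset.univ.filter fun i => f i = l.succ).card = α l
        then ∏ i, consOneEval p i (f i) else 0 := by
  classical
  have := coeff_prod_one_add_sum (finSuccEquiv a).symm
    (consOneEval p : Fin n → _) (by simp [consOneEval]) (Finsupp.equivFunOnFinite.symm α)
  simpa [consOneEval, esym] using this

theorem esym_pqFamily_eq_sum {K : Type*} [CommRing K] {n d a b : ℕ}
    (p : Fin a → MvPolynomial (Fin d) K) (q : Fin b → MvPolynomial (Fin d) K)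
    (γ : Fin (a + 1) → Fin (b + 1) → ℕ) :
    esym K n d
        (fun x : {x : Fin (a+1) × Fin (b+1) // x ≠ (0, 0)} => pqFamily p q x.1)
        (Finsupp.equivFunOnFinite.symm (fun x => γ x.1.1 x.1.2)) =
      ∑ h : Fin n → Fin (a + 1) × Fin (b + 1),
        if ∀ x, x ≠ (0, 0) → (Finset.univ.filter fun i => h i = x).card = γ x.1 x.2
          then ∏ i, consOneEval p i (h i).1 * consOneEval q i (h i).2 else 0 := by
  classical
  have := coeff_prod_one_add_sum (Equiv.optionSubtypeNe ((0, 0) : Fin (a + 1) × Fin (b + 1)))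
    (fun (i : Fin n) x => consOneEval p i x.1 * consOneEval q i x.2) (by simp [consOneEval])
    (Finsupp.equivFunOnFinite.symm (fun x => γ x.1.1 x.1.2))
  have key : ∀ (i : Fin n) (x : {x : Fin (a+1) × Fin (b+1) // x ≠ (0, 0)}),
      MvPolynomial.rename (fun j => (i, j)) (pqFamily p q x.1) =
        consOneEval p i x.1.1 * consOneEval q i x.1.2 := by
    rintro i ⟨⟨k, l⟩, hx⟩
    cases k using Fin.cases <;> cases l using Fin.cases <;>
      first
      | exact absurd rfl hx
      | simp [pqFamily, consOneEval, Fin.succ_ne_zero]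
  simp only [esym, key]
  simpa using this

/-- The matrix counting how often each position other than `(0, 0)` is attained. -/
def countMatrix {n a b : ℕ} (h : Fin n → Fin (a + 1) × Fin (b + 1)) :
    Fin (a + 1) → Fin (b + 1) → ℕ := fun k l =>
  if (k, l) = (0, 0) then 0 else (Finset.univ.filter fun i => h i = (k, l)).card

theorem sum_sum_countMatrix_le {n a b : ℕ} (h : Fin n → Fin (a + 1) × Fin (b + 1)) :
    ∑ k, ∑ l, countMatrix h k l ≤ n := by
  calc ∑ k, ∑ l, countMatrix h k l
      ≤ ∑ k, ∑ l, (Finset.univ.filter fun i => h i = (k, l)).card := by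
        refine Finset.sum_le_sum fun k _ => Finset.sum_le_sum fun l _ => ?_
        unfold countMatrix
        split_ifs <;> simp
    _ = ∑ x, (Finset.univ.filter fun i => h i = x).card := by rw [Fintype.sum_prod_type]
    _ = n := by
        rw [← Finset.card_eq_sum_card_fiberwise (fun _ _ => Finset.mem_coe.2 (Finset.mem_univ _))]
        simp

theorem sum_countMatrix_succ_left {n a b : ℕ} (h : Fin n → Fin (a + 1) × Fin (b + 1))
    (k : Fin a) :
    ∑ l, countMatrix h k.succ l = (Finset.univ.filter fun i => (h i).1 = k.succ).card := by
  rw [Finset.card_eq_sum_card_fiberwise (f := fun i => (h i).2) (t := Finset.univ)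
    (fun _ _ => Finset.mem_coe.2 (Finset.mem_univ _))]
  simp [countMatrix, Finset.filter_filter, Prod.ext_iff]

theorem sum_countMatrix_succ_right {n a b : ℕ} (h : Fin n → Fin (a + 1) × Fin (b + 1))
    (l : Fin b) :
    ∑ k, countMatrix h k l.succ = (Finset.univ.filter fun i => (h i).2 = l.succ).card := by
  rw [Finset.card_eq_sum_card_fiberwise (f := fun i => (h i).1) (t := Finset.univ)
    (fun _ _ => Finset.mem_coe.2 (Finset.mem_univ _))]
  simp [countMatrix, Finset.filter_filter, Prod.ext_iff, and_comm]

theorem isL_countMatrix_iff {n a b : ℕ} (α : Fin a → ℕ) (β : Fin b → ℕ)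
    (h : Fin n → Fin (a + 1) × Fin (b + 1)) :
    IsL α β n (countMatrix h) ↔
      (∀ k : Fin a, (Finset.univ.filter fun i => (h i).1 = k.succ).card = α k) ∧
      (∀ l : Fin b, (Finset.univ.filter fun i => (h i).2 = l.succ).card = β l) := by
  simp only [IsL, sum_countMatrix_succ_left, sum_countMatrix_succ_right, sum_sum_countMatrix_le,
    true_and, and_iff_right_iff_imp]
  simp [countMatrix]

theorem eq_countMatrix_iff {n a b : ℕ} (h : Fin n → Fin (a + 1) × Fin (b + 1))
    (γ : Fin (a + 1) → Fin (b + 1) → ℕ) :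
    γ = countMatrix h ↔ γ 0 0 = 0 ∧
      ∀ x, x ≠ (0, 0) → (Finset.univ.filter fun i => h i = x).card = γ x.1 x.2 := by
  constructor
  · rintro rfl
    refine ⟨by simp [countMatrix], fun x hx => ?_⟩
    simp only [countMatrix, Prod.mk.eta]
    rw [if_neg hx]
  · rintro ⟨h0, h1⟩
    funext k l
    by_cases hx : (k, l) = (0, 0)
    · obtain ⟨rfl, rfl⟩ := Prod.mk.inj hx
      simp [countMatrix, h0]
    · rw [← h1 (k, l) hx, countMatrix, if_neg hx]

/-- Vaccarino's product formula: for `α ∈ ℕ^a`, `β ∈ ℕ^b` with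
`|α|, |β| ≤ n` and families `p`, `q` of polynomials in `K[y_1,…,y_d]`,
`e_α(p) · e_β(q) = Σ_{γ ∈ L(α,β,n)} e_γ(p, q, pq)`,
where `(p,q,pq)` is indexed by `({0}∪[a]) × ({0}∪[b]) ∖ {(0,0)}` and `e_γ` is
the elementary multisymmetric function of this family with exponent `γ`. -/
theorem stmt0 {K : Type*} [CommRing K] (n d : ℕ) (hn : 1 ≤ n) (hd : 1 ≤ d)
    {a b : ℕ} (p : Fin a → MvPolynomial (Fin d) K) (q : Fin b → MvPolynomial (Fin d) K)
    (α : Fin a → ℕ) (β : Fin b → ℕ)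
    (hα : ∑ i, α i ≤ n) (hβ : ∑ j, β j ≤ n) :
    esym K n d p (Finsupp.equivFunOnFinite.symm α) *
        esym K n d q (Finsupp.equivFunOnFinite.symm β) =
      ∑ᶠ (γ : Fin (a+1) → Fin (b+1) → ℕ) (_ : IsL α β n γ),
        esym K n d
          (fun x : {x : Fin (a+1) × Fin (b+1) // x ≠ (0, 0)} => pqFamily p q x.1)
          (Finsupp.equivFunOnFinite.symm (fun x => γ x.1.1 x.1.2)) := by
  classical
  let w : (Fin n → Fin (a + 1) × Fin (b + 1)) → MvPolynomial (Fin n × Fin d) K := fun h =>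
    ∏ i, consOneEval p i (h i).1 * consOneEval q i (h i).2
  have summand : ∀ γ : Fin (a + 1) → Fin (b + 1) → ℕ,
      (∑ᶠ (_ : IsL α β n γ), esym K n d
          (fun x : {x : Fin (a+1) × Fin (b+1) // x ≠ (0, 0)} => pqFamily p q x.1)
          (Finsupp.equivFunOnFinite.symm (fun x => γ x.1.1 x.1.2))) =
        ∑ h : Fin n → Fin (a + 1) × Fin (b + 1),
          if γ = countMatrix h then (if IsL α β n (countMatrix h) then w h else 0) else 0 := by
    intro γ
    rw [finsum_eq_if, esym_pqFamily_eq_sum]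
    split_ifs with hγ
    · refine Finset.sum_congr rfl fun h _ => ?_
      by_cases hh : γ = countMatrix h
      · rw [if_pos ((eq_countMatrix_iff h γ).1 hh).2, if_pos hh, if_pos (hh ▸ hγ)]
      · rw [if_neg fun h2 => hh ((eq_countMatrix_iff h γ).2 ⟨hγ.1, h2⟩), if_neg hh]
    · refine (Finset.sum_eq_zero fun h _ => ?_).symm
      split_ifs with h1 h2
      · exact absurd (h1 ▸ h2) hγ
      · rfl
      · rfl
  simp_rw [summand]
  rw [finsum_sum_comm]
  · have single : ∀ h : Fin n → Fin (a + 1) × Fin (b + 1),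
        (∑ᶠ γ, if γ = countMatrix h then (if IsL α β n (countMatrix h) then w h else 0) else 0) =
          if IsL α β n (countMatrix h) then w h else 0 := by
      intro h
      rw [finsum_eq_single _ (countMatrix h) fun γ hγ => if_neg hγ, if_pos rfl]
    simp_rw [single, isL_countMatrix_iff]
    rw [esym_eq_sum_fin, esym_eq_sum_fin, Finset.sum_mul_sum, ← Fintype.sum_prod_type']
    refine Fintype.sum_equiv (Equiv.arrowProdEquivProdArrow (Fin n) (fun _ => Fin (a + 1))
      (fun _ => Fin (b + 1))).symm _ _ fun ⟨f, g⟩ => ?_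
    by_cases h1 : ∀ k : Fin a, (Finset.univ.filter fun i => f i = k.succ).card = α k
    · by_cases h2 : ∀ l : Fin b, (Finset.univ.filter fun i => g i = l.succ).card = β l
      · rw [if_pos h1, if_pos h2, ← Finset.prod_mul_distrib]
        exact (if_pos ⟨h1, h2⟩).symm
      · rw [if_neg h2, mul_zero]
        exact (if_neg fun h3 => h2 h3.2).symm
    · rw [if_neg h1, zero_mul]
      exact (if_neg fun h3 => h1 h3.1).symm
  · intro h _
    refine (Set.finite_singleton (countMatrix h)).subset fun γ hγ => ?_
    by_contra hne
    exact hγ (if_neg hne)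
end

section
/- Let a, b ≥ 1, α ∈ ℕ^a, β ∈ ℕ^b, n ∈ ℕ, and m ≥ 1. Let γ ∈ L(α,β,n) be such that γ_{rs} ≠ 0 for some r ∈ {1,…,a} and s ∈ {1,…,b}. Then there exists a cubical matrix Γ ∈ Q(α,β,n,m) whose smash equals γ, i.e., Σ_{k=0}^{∞} Γ_{ij}^k = γ_{ij} for all i, j. -/
open Finset

/-- Total size `|Γ| = Σ_{i,j,k} Γ_{ij}^k` of a cubical matrix. -/
def qTotal {a b : ℕ} (Γ : Fin (a+1) → Fin (b+1) → ℕ →₀ ℕ) : ℕ :=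
  ∑ i, ∑ j, (Γ i j).sum fun _ v => v

/-- Weight `Σ_{i,j,k} k·Γ_{ij}^k` of a cubical matrix. -/
def qWeight {a b : ℕ} (Γ : Fin (a+1) → Fin (b+1) → ℕ →₀ ℕ) : ℕ :=
  ∑ i, ∑ j, (Γ i j).sum fun k v => k * v

/-- The smash `Γ̄_{ij} = Σ_k Γ_{ij}^k` of a cubical matrix. -/
def smash {a b : ℕ} (Γ : Fin (a+1) → Fin (b+1) → ℕ →₀ ℕ) :
    Fin (a+1) → Fin (b+1) → ℕ :=
  fun i j => (Γ i j).sum fun _ v => v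

/-- Membership in `Q(α,β,n,m)`: cubical matrices (with finitely many nonzero
entries, encoded via finsupp in the level index `k`) satisfying the marginal
and weight conditions. -/
def IsCubical {a b : ℕ} (α : Fin a → ℕ) (β : Fin b → ℕ) (n m : ℕ)
    (Γ : Fin (a+1) → Fin (b+1) → ℕ →₀ ℕ) : Prop :=
  (∀ k : ℕ, Γ 0 0 k = 0) ∧
  (∀ (i : Fin (a+1)) (j : Fin (b+1)) (k : ℕ), 1 ≤ k → (i = 0 ∨ j = 0) → Γ i j k = 0) ∧
  qTotal Γ ≤ n ∧
  qWeight Γ = m ∧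
  (∀ i : Fin a, ∑ j, (Γ i.succ j).sum (fun _ v => v) = α i) ∧
  (∀ j : Fin b, ∑ i, (Γ i j.succ).sum (fun _ v => v) = β j)

/-- Membership in the support `Q^s(α,β,n,m)` at level `s`. -/
def InSupport {a b : ℕ} (α : Fin a → ℕ) (β : Fin b → ℕ) (n m s : ℕ)
    (Γ : Fin (a+1) → Fin (b+1) → ℕ →₀ ℕ) : Prop :=
  IsCubical α β n m Γ ∧
  (∀ (i : Fin (a+1)) (j : Fin (b+1)) (k : ℕ), s < k → Γ i j k = 0) ∧
  (∃ (i : Fin (a+1)) (j : Fin (b+1)), Γ i j s ≠ 0)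

/-- `ψ(Γ) = w` : the 3-word `w` (a `3 × N` matrix, given as the list of its `N`
columns) is obtained by concatenating, in lexicographic order of the triples
`(k,i,j)`, exactly `Γ_{ij}^k` copies of the column `(k, i+1, j+1)`. -/
def IsPsi {a b : ℕ} (Γ : Fin (a+1) → Fin (b+1) → ℕ →₀ ℕ) {N : ℕ}
    (w : Fin N → ℕ × ℕ × ℕ) : Prop :=
  (∀ t u : Fin N, t ≤ u →
    ((w t).1 < (w u).1 ∨ ((w t).1 = (w u).1 ∧
      ((w t).2.1 < (w u).2.1 ∨ ((w t).2.1 = (w u).2.1 ∧ (w t).2.2 ≤ (w u).2.2))))) ∧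
  (∀ (k : ℕ) (i : Fin (a+1)) (j : Fin (b+1)),
    (Finset.univ.filter (fun t => w t = (k, (i : ℕ) + 1, (j : ℕ) + 1))).card = Γ i j k) ∧
  (∀ t : Fin N, ∃ (k : ℕ) (i : Fin (a+1)) (j : Fin (b+1)),
    w t = (k, (i : ℕ) + 1, (j : ℕ) + 1))

/-- A 3-word: first row weakly increasing, second and third rows positive,
equal consecutive first-row entries force increasing second row, and equal
consecutive second-row entries force increasing third row. -/
def IsThreeWord {N : ℕ} (w : Fin N → ℕ × ℕ × ℕ) : Prop :=
  (∀ t u : Fin N, t ≤ u → (w t).1 ≤ (w u).1) ∧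
  (∀ t : Fin N, 1 ≤ (w t).2.1 ∧ 1 ≤ (w t).2.2) ∧
  (∀ (t : ℕ) (ht : t + 1 < N),
    ((w ⟨t, Nat.lt_of_succ_lt ht⟩).1 = (w ⟨t+1, ht⟩).1 →
      (w ⟨t, Nat.lt_of_succ_lt ht⟩).2.1 ≤ (w ⟨t+1, ht⟩).2.1) ∧
    ((w ⟨t, Nat.lt_of_succ_lt ht⟩).2.1 = (w ⟨t+1, ht⟩).2.1 →
      (w ⟨t, Nat.lt_of_succ_lt ht⟩).2.2 ≤ (w ⟨t+1, ht⟩).2.2))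

/-- Membership in `A(α,β,n,m)` for a 3-word with `N` columns. -/
def InA {a b : ℕ} (α : Fin a → ℕ) (β : Fin b → ℕ) (n m : ℕ) {N : ℕ}
    (w : Fin N → ℕ × ℕ × ℕ) : Prop :=
  IsThreeWord w ∧
  N ≤ n ∧
  (∀ t : Fin N, (w t).2.1 = (w t).2.2 → (w t).2.1 ≠ 1) ∧
  (∀ t : Fin N, 0 < (w t).1 → 1 < (w t).2.1 ∧ 1 < (w t).2.2) ∧
  (∑ t, (w t).1 = m) ∧
  (∀ t : Fin N, (w t).2.1 ≤ a + 1 ∧ (w t).2.2 ≤ b + 1) ∧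
  (∀ v : Fin a, (Finset.univ.filter (fun t => (w t).2.1 = (v : ℕ) + 2)).card = α v) ∧
  ((Finset.univ.filter (fun t : Fin N => (w t).2.1 = 1)).card = N - ∑ v, α v) ∧
  (∀ v : Fin b, (Finset.univ.filter (fun t => (w t).2.2 = (v : ℕ) + 2)).card = β v) ∧
  ((Finset.univ.filter (fun t : Fin N => (w t).2.2 = 1)).card = N - ∑ v, β v)
/-- Raise one unit of `γ` at position `p` to level `m`, keeping everything else at level `0`. -/
noncomputable def raiseOne {a b : ℕ} (γ : Fin (a+1) → Fin (b+1) → ℕ)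
    (p : Fin (a+1) × Fin (b+1)) (m : ℕ) : Fin (a+1) → Fin (b+1) → ℕ →₀ ℕ :=
  fun i j => if (i, j) = p then Finsupp.single m 1 + Finsupp.single 0 (γ i j - 1)
    else Finsupp.single 0 (γ i j)

theorem smash_raiseOne {a b : ℕ} (γ : Fin (a+1) → Fin (b+1) → ℕ)
    (p : Fin (a+1) × Fin (b+1)) (m : ℕ) (hp : γ p.1 p.2 ≠ 0) :
    smash (raiseOne γ p m) = γ := by
  funext i j
  unfold smash raiseOne
  split_ifs with h
  · subst h
    rw [Finsupp.sum_add_index' (by simp) (by simp), Finsupp.sum_single_index rfl,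
      Finsupp.sum_single_index rfl]
    exact Nat.add_sub_cancel' (Nat.one_le_iff_ne_zero.mpr hp)
  · exact Finsupp.sum_single_index rfl

theorem qWeight_raiseOne {a b : ℕ} (γ : Fin (a+1) → Fin (b+1) → ℕ)
    (p : Fin (a+1) × Fin (b+1)) (m : ℕ) : qWeight (raiseOne γ p m) = m := by
  have key : ∀ i j, ((raiseOne γ p m i j).sum fun k v => k * v) =
      if (i, j) = p then m else 0 := by
    intro i j
    unfold raiseOne
    split_ifs with h
    · rw [Finsupp.sum_add_index' (by simp) (by intros; ring), Finsupp.sum_single_index (by simp),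
        Finsupp.sum_single_index (by simp)]
      simp
    · simp
  unfold qWeight
  simp_rw [key]
  rw [← Fintype.sum_prod_type' (f := fun i j => if (i, j) = p then m else 0)]
  simp

/-- for `m ≥ 1` and `γ ∈ L(α,β,n)` with a nonzero entry `γ_{rs}`,
`r ∈ [a]`, `s ∈ [b]`, there is `Γ ∈ Q(α,β,n,m)` whose smash equals `γ`. -/
theorem stmt7 {a b : ℕ} (ha : 1 ≤ a) (hb : 1 ≤ b)
    (α : Fin a → ℕ) (β : Fin b → ℕ) (n m : ℕ) (hm : 1 ≤ m)
    (γ : Fin (a+1) → Fin (b+1) → ℕ) (hγ : IsL α β n γ)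
    (r : Fin a) (s : Fin b) (hrs : γ r.succ s.succ ≠ 0) :
    ∃ Γ : Fin (a+1) → Fin (b+1) → ℕ →₀ ℕ,
      IsCubical α β n m Γ ∧ smash Γ = γ := by
  obtain ⟨h0, hn, hα, hβ⟩ := hγ
  have hs := smash_raiseOne γ (r.succ, s.succ) m hrs
  have hs' : ∀ i j, ((raiseOne γ (r.succ, s.succ) m i j).sum fun _ v => v) = γ i j :=
    fun i j => congrFun (congrFun hs i) j
  refine ⟨raiseOne γ (r.succ, s.succ) m, ⟨?_, ?_, ?_, qWeight_raiseOne _ _ _, ?_, ?_⟩, hs⟩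
  · intro k
    simp [raiseOne, h0, (Fin.succ_ne_zero r).symm]
  · intro i j k hk hij
    have hne : (i, j) ≠ (r.succ, s.succ) := by
      rintro h
      obtain ⟨rfl, rfl⟩ := Prod.mk.inj h
      simp at hij
    rw [raiseOne, if_neg hne, Finsupp.single_eq_of_ne (by lia)]
  · simpa only [qTotal, hs'] using hn
  · simpa only [hs'] using hα
  · simpa only [hs'] using hβ
end

section
/- For all a, b ≥ 1, α ∈ ℕ^a, β ∈ ℕ^b, and n ∈ ℕ, for every γ ∈ L(α,β,n), the number of cubical matrices Γ ∈ Q(α,β,n,1) whose smash equals γ is exactly f_γ = #{(i,j) ∈ {1,…,a} × {1,…,b} : γ_{ij} ≠ 0}. -/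
open Finset

theorem Finset.exists_eq_one_of_sum_eq_one {ι : Type*} {s : Finset ι} {g : ι → ℕ}
    (h : ∑ i ∈ s, g i = 1) :
    ∃ i ∈ s, g i = 1 ∧ ∀ j ∈ s, j ≠ i → g j = 0 := by
  classical
  obtain ⟨i, hi, hne⟩ := exists_ne_zero_of_sum_ne_zero (by rw [h]; exact one_ne_zero)
  have hsplit := add_sum_erase s g hi
  refine ⟨i, hi, by omega, fun j hj hji => ?_⟩
  have hzero : ∑ j ∈ s.erase i, g j = 0 := by omega
  exact sum_eq_zero_iff.mp hzero j (mem_erase.mpr ⟨hji, hj⟩)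

theorem Finsupp.eq_single_zero_of_weight_eq_zero {f : ℕ →₀ ℕ}
    (h : (f.sum fun k v => k * v) = 0) :
    f = Finsupp.single 0 (f.sum fun _ v => v) := by
  have hf : f = Finsupp.single 0 (f 0) := by
    ext k
    rcases Nat.eq_zero_or_pos k with rfl | hk
    · simp
    · rw [Finsupp.single_eq_of_ne hk.ne']
      by_contra hne
      have := sum_eq_zero_iff.mp h k (Finsupp.mem_support_iff.mpr hne)
      simp_all
  rw [hf]
  simp

theorem Finsupp.eq_add_of_weight_eq_one {f : ℕ →₀ ℕ}
    (h : (f.sum fun k v => k * v) = 1) :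
    (f.sum fun _ v => v) ≠ 0 ∧
      f = Finsupp.single 0 ((f.sum fun _ v => v) - 1) + Finsupp.single 1 1 := by
  obtain ⟨k, -, hk, hother⟩ := exists_eq_one_of_sum_eq_one h
  obtain ⟨rfl, hf1⟩ := mul_eq_one.mp hk
  have hf : f = Finsupp.single 0 (f 0) + Finsupp.single 1 1 := by
    ext l
    by_cases h1 : l = 1
    · subst h1
      simp [hf1]
    rcases Nat.eq_zero_or_pos l with rfl | hl
    · simp
    · rw [Finsupp.add_apply, Finsupp.single_eq_of_ne hl.ne', Finsupp.single_eq_of_ne h1]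
      by_contra hne
      have := hother l (Finsupp.mem_support_iff.mpr hne) h1
      simp_all
  have hsum : (f.sum fun _ v => v) = f 0 + 1 := by
    conv_lhs => rw [hf]
    rw [Finsupp.sum_add_index' (by simp) (by simp)]
    simp
  refine ⟨by omega, ?_⟩
  rw [hsum]
  exact hf

/-- The cubical matrix with smash `γ` obtained by raising one unit of the entry at `p` to
level `1` and keeping everything else at level `0`. -/
noncomputable def raise {a b : ℕ} (γ : Fin (a+1) → Fin (b+1) → ℕ) (p : Fin a × Fin b) :
    Fin (a+1) → Fin (b+1) → ℕ →₀ ℕ :=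
  fun i j => if (i, j) = (p.1.succ, p.2.succ) then
      Finsupp.single 0 (γ i j - 1) + Finsupp.single 1 1
    else Finsupp.single 0 (γ i j)

theorem raise_injective {a b : ℕ} (γ : Fin (a+1) → Fin (b+1) → ℕ) :
    Function.Injective (raise γ) := by
  intro p q h
  by_contra hne
  have h1 : raise γ p p.1.succ p.2.succ 1 = raise γ q p.1.succ p.2.succ 1 := by rw [h]
  have hpq : ¬ (p.1 = q.1 ∧ p.2 = q.2) := fun h => hne (Prod.ext h.1 h.2)
  simp [raise, hpq] at h1

theorem smash_raise {a b : ℕ} {γ : Fin (a+1) → Fin (b+1) → ℕ} {p : Fin a × Fin b}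
    (hp : γ p.1.succ p.2.succ ≠ 0) : smash (raise γ p) = γ := by
  funext i j
  unfold smash raise
  split_ifs with h
  · obtain ⟨rfl, rfl⟩ := Prod.mk.inj h
    rw [Finsupp.sum_add_index' (by simp) (by simp), Finsupp.sum_single_index rfl,
      Finsupp.sum_single_index rfl]
    exact Nat.sub_add_cancel (Nat.one_le_iff_ne_zero.mpr hp)
  · simp

theorem qWeight_raise {a b : ℕ} (γ : Fin (a+1) → Fin (b+1) → ℕ) (p : Fin a × Fin b) :
    qWeight (raise γ p) = 1 := by
  have hentry : ∀ i j, ((raise γ p i j).sum fun k v => k * v) =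
      if (i, j) = (p.1.succ, p.2.succ) then 1 else 0 := by
    intro i j
    unfold raise
    split_ifs with h
    · rw [Finsupp.sum_add_index' (by simp) (by simp [mul_add]),
        Finsupp.sum_single_index rfl, Finsupp.sum_single_index rfl, zero_mul, mul_one]
    · simp
  unfold qWeight
  simp_rw [hentry]
  rw [← Fintype.sum_prod_type' (f := fun i j => if (i, j) = (p.1.succ, p.2.succ) then 1 else 0)]
  simp

theorem isCubical_raise {a b : ℕ} {α : Fin a → ℕ} {β : Fin b → ℕ} {n : ℕ}
    {γ : Fin (a+1) → Fin (b+1) → ℕ} (hγ : IsL α β n γ) {p : Fin a × Fin b}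
    (hp : γ p.1.succ p.2.succ ≠ 0) : IsCubical α β n 1 (raise γ p) := by
  obtain ⟨h0, hn, hα, hβ⟩ := hγ
  have hs : ∀ i j, ((raise γ p i j).sum fun _ v => v) = γ i j :=
    fun i j => congrFun (congrFun (smash_raise hp) i) j
  have hborder : ∀ i j, (i = 0 ∨ j = 0) → raise γ p i j = Finsupp.single 0 (γ i j) := by
    intro i j hij
    refine if_neg fun h => ?_
    obtain ⟨rfl, rfl⟩ := Prod.mk.inj h
    simp at hij
  refine ⟨fun k => ?_, fun i j k hk hij => ?_, ?_, qWeight_raise γ p, ?_, ?_⟩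
  · simp [hborder 0 0 (Or.inl rfl), h0]
  · rw [hborder i j hij, Finsupp.single_eq_of_ne (by omega)]
  · simpa only [qTotal, hs] using hn
  · simpa only [hs] using hα
  · simpa only [hs] using hβ

theorem IsCubical.exists_eq_raise {a b : ℕ} {α : Fin a → ℕ} {β : Fin b → ℕ} {n : ℕ}
    {Γ : Fin (a+1) → Fin (b+1) → ℕ →₀ ℕ} (hΓ : IsCubical α β n 1 Γ) :
    ∃ p : Fin a × Fin b, smash Γ p.1.succ p.2.succ ≠ 0 ∧ raise (smash Γ) p = Γ := by
  obtain ⟨-, hborder, -, hw, -, -⟩ := hΓ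
  unfold qWeight at hw
  rw [← Fintype.sum_prod_type' (f := fun i j => (Γ i j).sum fun k v => k * v)] at hw
  obtain ⟨⟨i, j⟩, -, hij, hother⟩ := exists_eq_one_of_sum_eq_one hw
  obtain ⟨hne, heq⟩ := Finsupp.eq_add_of_weight_eq_one hij
  have h1 : Γ i j 1 ≠ 0 := by
    rw [heq]
    simp
  have hi : i ≠ 0 := fun h => h1 (hborder i j 1 le_rfl (Or.inl h))
  have hj : j ≠ 0 := fun h => h1 (hborder i j 1 le_rfl (Or.inr h))
  obtain ⟨i, rfl⟩ := Fin.exists_succ_eq.mpr hi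
  obtain ⟨j, rfl⟩ := Fin.exists_succ_eq.mpr hj
  refine ⟨(i, j), hne, ?_⟩
  funext k l
  unfold raise
  split_ifs with h
  · obtain ⟨rfl, rfl⟩ := Prod.mk.inj h
    exact heq.symm
  · exact (Finsupp.eq_single_zero_of_weight_eq_zero (hother (k, l) (mem_univ _) h)).symm

/-- for every `γ ∈ L(α,β,n)`, the number of `Γ ∈ Q(α,β,n,1)` whose
smash equals `γ` is `f_γ = #{(i,j) ∈ [a]×[b] : γ_{ij} ≠ 0}`. -/
theorem stmt8 {a b : ℕ} (ha : 1 ≤ a) (hb : 1 ≤ b)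
    (α : Fin a → ℕ) (β : Fin b → ℕ) (n : ℕ)
    (γ : Fin (a+1) → Fin (b+1) → ℕ) (hγ : IsL α β n γ) :
    Set.ncard {Γ : Fin (a+1) → Fin (b+1) → ℕ →₀ ℕ |
        IsCubical α β n 1 Γ ∧ smash Γ = γ} =
      (Finset.univ.filter (fun x : Fin a × Fin b => γ x.1.succ x.2.succ ≠ 0)).card := by
  have himage : {Γ : Fin (a+1) → Fin (b+1) → ℕ →₀ ℕ | IsCubical α β n 1 Γ ∧ smash Γ = γ} =
      raise γ '' (Finset.univ.filter
        (fun x : Fin a × Fin b => γ x.1.succ x.2.succ ≠ 0) : Finset (Fin a × Fin b)) := by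
    ext Γ
    constructor
    · rintro ⟨hΓ, rfl⟩
      obtain ⟨p, hp, hpΓ⟩ := hΓ.exists_eq_raise
      exact ⟨p, by simpa using hp, hpΓ⟩
    · rintro ⟨p, hp, rfl⟩
      have hp' : γ p.1.succ p.2.succ ≠ 0 := by simpa using hp
      exact ⟨isCubical_raise hγ hp', smash_raise hp'⟩
  rw [himage, Set.ncard_image_of_injective _ (raise_injective γ), Set.ncard_coe_finset]
end

section
/- Let a, b ≥ 1, α ∈ ℕ^a, β ∈ ℕ^b, n, m ∈ ℕ, and let Ω be any 3-word in A(α,β,n,m). Then there exists Γ ∈ Q(α,β,n,m) with ψ(Γ) = Ω, where Γ_{ij}^k is the number of columns of Ω equal to (k, i+1, j+1). -/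
open Finset

/-- The finitely supported function `k ↦ #{t | I t = i ∧ J t = j ∧ K t = k}`, for each `i` and
`j`. -/
noncomputable def columnCount {ι κ : Type*} [DecidableEq ι] [DecidableEq κ] {N : ℕ}
    (K : Fin N → ℕ) (I : Fin N → ι) (J : Fin N → κ) (i : ι) (j : κ) : ℕ →₀ ℕ :=
  ∑ t with I t = i ∧ J t = j, Finsupp.single (K t) 1

section columnCount

variable {ι κ : Type*} [DecidableEq ι] [DecidableEq κ] {N : ℕ}
  (K : Fin N → ℕ) (I : Fin N → ι) (J : Fin N → κ)

theorem columnCount_apply (i : ι) (j : κ) (k : ℕ) :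
    columnCount K I J i j k = #{t | I t = i ∧ J t = j ∧ K t = k} := by
  simp [columnCount, Finsupp.finsetSum_apply, Finsupp.single_apply,
    Finset.filter_filter, and_assoc]

theorem columnCount_sum_mul (f : ℕ → ℕ) (i : ι) (j : κ) :
    ((columnCount K I J i j).sum fun k v => f k * v) =
      ∑ t, if I t = i then if J t = j then f (K t) else 0 else 0 := by
  rw [columnCount, ← Finsupp.sum_finsetSum_index (by simp) (by simp [mul_add])]
  simp [Finset.sum_filter, ite_and]

theorem columnCount_sum_mul_right [Fintype κ] (f : ℕ → ℕ) (i : ι) :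
    (∑ j, (columnCount K I J i j).sum fun k v => f k * v) =
      ∑ t, if I t = i then f (K t) else 0 := by
  simp_rw [columnCount_sum_mul]
  rw [Finset.sum_comm]
  refine Finset.sum_congr rfl fun t _ => ?_
  split_ifs <;> simp

theorem columnCount_sum_mul_left [Fintype ι] (f : ℕ → ℕ) (j : κ) :
    (∑ i, (columnCount K I J i j).sum fun k v => f k * v) =
      ∑ t, if J t = j then f (K t) else 0 := by
  simp_rw [columnCount_sum_mul]
  rw [Finset.sum_comm]
  simp

theorem columnCount_sum_mul_univ [Fintype ι] [Fintype κ] (f : ℕ → ℕ) :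
    (∑ i, ∑ j, (columnCount K I J i j).sum fun k v => f k * v) = ∑ t, f (K t) := by
  simp_rw [columnCount_sum_mul_right]
  rw [Finset.sum_comm]
  simp

end columnCount

/-- The columns of a 3-word are weakly increasing for the lexicographic order. -/
theorem IsThreeWord.lex_le {N : ℕ} {w : Fin N → ℕ × ℕ × ℕ} (h : IsThreeWord w)
    {t u : Fin N} (htu : t ≤ u) :
    (w t).1 < (w u).1 ∨ ((w t).1 = (w u).1 ∧
      ((w t).2.1 < (w u).2.1 ∨ ((w t).2.1 = (w u).2.1 ∧ (w t).2.2 ≤ (w u).2.2))) := by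
  obtain ⟨hmono, -, hstep⟩ := h
  obtain ⟨t, ht⟩ := t
  obtain ⟨u, hu⟩ := u
  replace htu : t ≤ u := htu
  induction u, htu using Nat.le_induction with
  | base => simp
  | succ u _ ih =>
    have h₁ := ih (by lia)
    have h₂ := hstep u hu
    have h₃ : (w ⟨u, by lia⟩).1 ≤ (w ⟨u + 1, hu⟩).1 := hmono _ _ (by simp)
    lia

/-- every 3-word `Ω ∈ A(α,β,n,m)` is `ψ(Γ)` for some
`Γ ∈ Q(α,β,n,m)`, namely with `Γ_{ij}^k` the number of columns of `Ω` equal to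
`(k, i+1, j+1)`. -/
theorem stmt19 {a b : ℕ} (ha : 1 ≤ a) (hb : 1 ≤ b)
    (α : Fin a → ℕ) (β : Fin b → ℕ) (n m : ℕ)
    {N : ℕ} (w : Fin N → ℕ × ℕ × ℕ) (hw : InA α β n m w) :
    ∃ Γ : Fin (a+1) → Fin (b+1) → ℕ →₀ ℕ,
      IsCubical α β n m Γ ∧ IsPsi Γ w ∧
      (∀ (k : ℕ) (i : Fin (a+1)) (j : Fin (b+1)),
        Γ i j k =
          (Finset.univ.filter
            (fun t : Fin N => w t = (k, (i : ℕ) + 1, (j : ℕ) + 1))).card) := by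
  obtain ⟨hword, hN, hdiag, hpos, hm, hle, hα, -, hβ, -⟩ := hw
  have hcol : ∀ t, ∃ (i : Fin (a+1)) (j : Fin (b+1)),
      (w t).2.1 = (i : ℕ) + 1 ∧ (w t).2.2 = (j : ℕ) + 1 := fun t => by
    have h₁ := hword.2.1 t
    have h₂ := hle t
    exact ⟨⟨(w t).2.1 - 1, by lia⟩, ⟨(w t).2.2 - 1, by lia⟩,
      by simp only; lia, by simp only; lia⟩
  choose I J hI hJ using hcol
  have hcount : ∀ k i j, columnCount (fun t => (w t).1) I J i j k =
      #{t | w t = (k, (i : ℕ) + 1, (j : ℕ) + 1)} := fun k i j => by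
    rw [columnCount_apply]
    congr 1
    ext t
    simp only [Finset.mem_filter, Finset.mem_univ, true_and, Prod.ext_iff, hI, hJ,
      Nat.add_right_cancel_iff, Fin.val_inj]
    tauto
  refine ⟨columnCount (fun t => (w t).1) I J, ⟨fun k => ?_, fun i j k hk hij => ?_, ?_, ?_,
    fun i => ?_, fun j => ?_⟩, ⟨fun t u => hword.lex_le, fun k i j => (hcount k i j).symm,
    fun t => ⟨(w t).1, I t, J t, by simp [Prod.ext_iff, hI, hJ]⟩⟩, hcount⟩
  · rw [hcount, Finset.card_eq_zero, Finset.filter_eq_empty_iff]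
    intro t _ ht
    exact hdiag t (by simp [ht]) (by simp [ht])
  · rw [hcount, Finset.card_eq_zero, Finset.filter_eq_empty_iff]
    intro t _ ht
    have := hpos t (by rw [ht]; exact hk)
    rcases hij with rfl | rfl <;> simp [ht] at this
  · have := columnCount_sum_mul_univ (fun t => (w t).1) I J fun _ => 1
    simp only [one_mul] at this
    simpa [qTotal, this] using hN
  · exact (columnCount_sum_mul_univ (fun t => (w t).1) I J fun k => k).trans hm
  · have := columnCount_sum_mul_right (fun t => (w t).1) I J (fun _ => 1) i.succ
    simp only [one_mul] at this
    rw [this, ← hα i, Finset.card_filter]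
    simp [hI, Fin.ext_iff]
  · have := columnCount_sum_mul_left (fun t => (w t).1) I J (fun _ => 1) j.succ
    simp only [one_mul] at this
    rw [this, ← hβ j, Finset.card_filter]
    simp [hJ, Fin.ext_iff]
end
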